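/- arXiv:1705.01800 — 3 statements merged into one kernel-verified Lean document; each statement's English description precedes it below -/
import Mathlib

section
/- For all positive integers n and r with n < r, the number N(n,r) of unlabeled (n,r)-bipartite graphs satisfies n! · N(n,r) ≤ 2 · C(r + 2^n - 1, r), where C(a,b) denotes the binomial coefficient. -/
/-- `numBip n r` is the number of orbits of the action of `S_n × S_r` on
`n × r` binary matrices `M : Fin n → Fin r → Bool`, where the pair `(α, β)`
sends `M` to the matrix `(i, j) ↦ M (α⁻¹ i) (β⁻¹ j)`. -/
noncomputable def numBip (n r : ℕ) : ℕ :=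
  Nat.card (Quot (fun M M' : Fin n → Fin r → Bool =>
    ∃ (α : Equiv.Perm (Fin n)) (β : Equiv.Perm (Fin r)),
      ∀ i j, M' i j = M (α⁻¹ i) (β⁻¹ j)))

open Finset

section InvariantFunctions

variable {X : Type*} [Fintype X] [DecidableEq X]

/-- Multisets of size `r` on `X`, given by their multiplicity functions, that are invariant
under the permutation `σ`. -/
def invariantMultisets (σ : Equiv.Perm X) (r : ℕ) : Finset (X → ℕ) :=
  {c ∈ piAntidiag univ r | ∀ x, c (σ x) = c x}

lemma mem_invariantMultisets {σ : Equiv.Perm X} {r : ℕ} {c : X → ℕ} :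
    c ∈ invariantMultisets σ r ↔ ∑ x, c x = r ∧ ∀ x, c (σ x) = c x := by
  simp [invariantMultisets]

/-- Exchanging an invariant part `d` for an invariant part `e` injects the invariant multisets
of size `r + s` containing `x` into those of size `r`. -/
lemma sum_invariantMultisets_le_of_exchange (σ : Equiv.Perm X) (x : X) (r s : ℕ) (d e : X → ℕ)
    (hd : ∀ y, d (σ y) = d y) (he : ∀ y, e (σ y) = e y) (hdx : d x = 1) (hex : e x = 0)
    (hs : ∑ y, d y = ∑ y, e y + s)
    (hle : ∀ c : X → ℕ, (∀ y, c (σ y) = c y) → c x ≠ 0 → ∀ y, d y ≤ c y) :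
    ∑ c ∈ invariantMultisets σ (r + s), c x ≤ ∑ c ∈ invariantMultisets σ r, (c x + 1) := by
  classical
  set B := {c ∈ invariantMultisets σ (r + s) | c x ≠ 0} with hB
  have hBle : ∀ c ∈ B, ∀ y, d y ≤ c y := fun c hc y => by
    rw [hB, mem_filter, mem_invariantMultisets] at hc
    exact hle c hc.1.2 hc.2 y
  let φ : (X → ℕ) → X → ℕ := fun c y => c y - d y + e y
  have hinj : Set.InjOn φ (B : Set (X → ℕ)) := by
    intro c hc c' hc' h
    funext y
    have h1 := congrFun h y
    have h2 := hBle c hc y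
    have h3 := hBle c' hc' y
    simp only [φ] at h1
    omega
  calc ∑ c ∈ invariantMultisets σ (r + s), c x = ∑ c ∈ B, c x := (sum_filter_ne_zero _).symm
    _ = ∑ c ∈ B, (φ c x + 1) := by
        refine sum_congr rfl fun c hc => ?_
        have := hBle c hc x
        simp only [φ]
        omega
    _ = ∑ c ∈ B.image φ, (c x + 1) := (sum_image (f := fun c => c x + 1) hinj).symm
    _ ≤ ∑ c ∈ invariantMultisets σ r, (c x + 1) := by
        refine sum_le_sum_of_subset fun c hc => ?_
        obtain ⟨c, hcB, rfl⟩ := mem_image.1 hc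
        have hle' := hBle c hcB
        rw [hB, mem_filter, mem_invariantMultisets] at hcB
        refine mem_invariantMultisets.2 ⟨?_, fun y => by simp only [φ, hd, he, hcB.1.2]⟩
        have h1 : ∑ y, φ c y + ∑ y, d y = ∑ y, c y + ∑ y, e y := by
          rw [← sum_add_distrib, ← sum_add_distrib]
          refine sum_congr rfl fun y _ => ?_
          have := hle' y
          simp only [φ]
          omega
        have := hcB.1.1
        omega

lemma sum_invariantMultisets_succ_le (σ : Equiv.Perm X) {x : X} (hx : σ x = x) (r : ℕ) :
    ∑ c ∈ invariantMultisets σ (r + 1), c x ≤ ∑ c ∈ invariantMultisets σ r, (c x + 1) := by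
  refine sum_invariantMultisets_le_of_exchange σ x r 1 (Pi.single x 1) 0 (fun y => ?_)
    (fun _ => rfl) (by simp) rfl (by simp) fun c _ hcx y => ?_
  · have : σ y = x ↔ y = x := by rw [← hx, σ.injective.eq_iff, hx]
    simp [Pi.single_apply, this]
  · by_cases h : y = x
    · subst h; simp; omega
    · simp [h]

lemma sum_invariantMultisets_add_two_le (σ : Equiv.Perm X) {x z : X} (hx : σ x ≠ x)
    (hz : σ z = z) (r : ℕ) :
    ∑ c ∈ invariantMultisets σ (r + 2), c x ≤ ∑ c ∈ invariantMultisets σ r, (c x + 1) := by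
  classical
  have hxz : x ≠ z := fun h => hx (h ▸ hz)
  let d : X → ℕ := fun y => if σ.SameCycle x y then 1 else 0
  have hd2 : 2 ≤ ∑ y, d y := by
    have : ∑ y ∈ {x, σ x}, d y ≤ ∑ y, d y := sum_le_sum_of_subset (subset_univ _)
    rw [sum_pair hx.symm] at this
    simpa [d, Equiv.Perm.SameCycle.refl] using this
  refine sum_invariantMultisets_le_of_exchange σ x r 2 d (Pi.single z (∑ y, d y - 2))
    (fun y => by simp [d]) (fun y => ?_) (by simp [d, Equiv.Perm.SameCycle.refl]) (by simp [hxz]) ?_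
    fun c hc hcx y => ?_
  · have : σ y = z ↔ y = z := by rw [← hz, σ.injective.eq_iff, hz]
    simp [Pi.single_apply, this]
  · simp; omega
  · by_cases h : σ.SameCycle x y
    · obtain ⟨k, -, rfl⟩ := h.exists_pow_eq'
      have : ∀ k : ℕ, c ((σ ^ k) x) = c x := fun k => by
        induction k with
        | zero => simp
        | succ k ih => rw [pow_succ', Equiv.Perm.mul_apply, hc, ih]
      rw [this]
      simp only [d]
      split_ifs
      omega
    · simp [d, h]

lemma sum_invariantMultisets_one (σ : Equiv.Perm X) {x : X} (hx : σ x ≠ x) :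
    ∑ c ∈ invariantMultisets σ 1, c x = 0 := by
  refine sum_eq_zero fun c hc => ?_
  obtain ⟨h1, h2⟩ := mem_invariantMultisets.1 hc
  have : ∑ y ∈ {x, σ x}, c y ≤ ∑ y, c y := sum_le_sum_of_subset (subset_univ _)
  rw [sum_pair hx.symm, h2] at this
  omega

lemma mul_card_invariantMultisets (σ : Equiv.Perm X) (r : ℕ) :
    r * #(invariantMultisets σ r) = ∑ x, ∑ c ∈ invariantMultisets σ r, c x := by
  rw [sum_comm, sum_congr rfl fun c hc => (mem_invariantMultisets.1 hc).1]
  simp [mul_comm]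

lemma card_invariantMultisets_one_le (σ : Equiv.Perm X) :
    #(invariantMultisets σ 1) ≤ #{x | σ x = x} * #(invariantMultisets σ 0) := by
  have h := mul_card_invariantMultisets σ 1
  rw [one_mul] at h
  rw [h, ← sum_filter_add_sum_filter_not univ (fun x => σ x = x),
    sum_eq_zero (s := {x | ¬ σ x = x}) fun x hx =>
      sum_invariantMultisets_one σ (mem_filter.1 hx).2, add_zero, ← smul_eq_mul]
  refine sum_le_card_nsmul _ _ _ fun x hx => ?_
  refine (sum_invariantMultisets_succ_le σ (mem_filter.1 hx).2 0).trans ?_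
  rw [card_eq_sum_ones]
  refine sum_le_sum fun c hc => ?_
  have := (mem_invariantMultisets.1 hc).1
  simp only [sum_eq_zero_iff, mem_univ, true_imp_iff] at this
  simp [this]

lemma add_two_mul_card_invariantMultisets_le (σ : Equiv.Perm X) {z : X} (hz : σ z = z) (r : ℕ) :
    (r + 2) * #(invariantMultisets σ (r + 2)) ≤
      #{x | σ x = x} * #(invariantMultisets σ (r + 1)) +
        (r + Fintype.card X) * #(invariantMultisets σ r) := by
  have hx : ∀ x, ∑ c ∈ invariantMultisets σ (r + 2), c x ≤
      (if σ x = x then #(invariantMultisets σ (r + 1)) else 0) +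
        (∑ c ∈ invariantMultisets σ r, c x + #(invariantMultisets σ r)) := fun x => by
    have hsum : ∀ r, ∑ c ∈ invariantMultisets σ r, (c x + 1) =
        ∑ c ∈ invariantMultisets σ r, c x + #(invariantMultisets σ r) := fun r => by
      rw [sum_add_distrib, card_eq_sum_ones]
    split_ifs with h
    · have h1 := sum_invariantMultisets_succ_le σ h (r + 1)
      have h2 := sum_invariantMultisets_succ_le σ h r
      rw [hsum, add_assoc r 1 1, one_add_one_eq_two] at h1
      rw [hsum] at h2
      omega
    · have h1 := sum_invariantMultisets_add_two_le σ h hz r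
      rw [hsum] at h1
      omega
  rw [mul_card_invariantMultisets]
  refine (sum_le_sum fun x _ => hx x).trans (le_of_eq ?_)
  rw [sum_add_distrib, sum_add_distrib, ← mul_card_invariantMultisets, ← sum_filter, sum_const,
    sum_const, card_univ, smul_eq_mul, smul_eq_mul]
  ring

/-- `r!` times the number of multisets of size `r` invariant under a permutation with `F` fixed
points and `(N - F) / 2` transpositions. -/
def involutionCount (N F : ℕ) : ℕ → ℕ
  | 0 => 1
  | 1 => F
  | r + 2 => F * involutionCount N F (r + 1) + (r + 1) * (N + r) * involutionCount N F r

lemma factorial_mul_card_invariantMultisets_le (σ : Equiv.Perm X) {z : X} (hz : σ z = z)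
    (r : ℕ) :
    r.factorial * #(invariantMultisets σ r) ≤
      involutionCount (Fintype.card X) #{x | σ x = x} r := by
  have h0 : #(invariantMultisets σ 0) ≤ 1 := by
    refine card_le_one.2 fun c hc c' hc' => ?_
    have h1 := (mem_invariantMultisets.1 hc).1
    have h2 := (mem_invariantMultisets.1 hc').1
    simp only [sum_eq_zero_iff, mem_univ, true_imp_iff] at h1 h2
    funext x
    rw [h1, h2]
  induction r using Nat.twoStepInduction with
  | zero => simpa [involutionCount] using h0
  | one =>
    simp only [Nat.factorial_one, one_mul, involutionCount]
    exact (card_invariantMultisets_one_le σ).trans (by simpa using Nat.mul_le_mul_left _ h0)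
  | more r ih1 ih2 =>
    calc (r + 2).factorial * #(invariantMultisets σ (r + 2))
        = (r + 1).factorial * ((r + 2) * #(invariantMultisets σ (r + 2))) := by
          rw [Nat.factorial_succ (r + 1)]; ring
      _ ≤ (r + 1).factorial * (#{x | σ x = x} * #(invariantMultisets σ (r + 1)) +
            (r + Fintype.card X) * #(invariantMultisets σ r)) :=
          Nat.mul_le_mul_left _ (add_two_mul_card_invariantMultisets_le σ hz r)
      _ = #{x | σ x = x} * ((r + 1).factorial * #(invariantMultisets σ (r + 1))) +
            (r + 1) * (Fintype.card X + r) * (r.factorial * #(invariantMultisets σ r)) := by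
          rw [Nat.factorial_succ r]; ring
      _ ≤ _ := by
          rw [involutionCount]
          gcongr

end InvariantFunctions

section Stirling

variable {R : Type*} [CommSemiring R]

/-- The sum of `g c` over the permutations of `Fin n`, where `c` is the number of cycles. -/
def cycleSum : ℕ → (ℕ → R) → R
  | 0, g => g 0
  | n + 1, g => cycleSum n fun c => g (c + 1) + n * g c

/-- The permutation of binary vectors induced by a permutation of the coordinates. -/
def coordPerm {n : ℕ} (α : Equiv.Perm (Fin n)) : Equiv.Perm (Fin n → Bool) :=
  α.symm.arrowCongr (Equiv.refl Bool)

lemma coordPerm_apply {n : ℕ} (α : Equiv.Perm (Fin n)) (v : Fin n → Bool) :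
    coordPerm α v = v ∘ α := by
  funext i; simp [coordPerm]

/-- The number of binary vectors constant on the cycles of `α`. -/
def numFixed {n : ℕ} (α : Equiv.Perm (Fin n)) : ℕ :=
  #{v | coordPerm α v = v}

lemma numFixed_decomposeFin_zero {n : ℕ} (e : Equiv.Perm (Fin n)) :
    numFixed (Equiv.Perm.decomposeFin.symm (0, e)) = 2 * numFixed e := by
  have : 2 * numFixed e =
      #((univ : Finset Bool) ×ˢ ({v | coordPerm e v = v} : Finset (Fin n → Bool))) := by
    simp [numFixed, card_product]
  rw [this, numFixed]
  refine card_equiv (Fin.consEquiv fun _ => Bool).symm fun v => ?_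
  simp [coordPerm_apply, funext_iff, Fin.forall_fin_succ, Fin.consEquiv, Fin.tail]

lemma numFixed_decomposeFin_succ {n : ℕ} (e : Equiv.Perm (Fin n)) (p : Fin n) :
    numFixed (Equiv.Perm.decomposeFin.symm (p.succ, e)) = numFixed e := by
  have key : ∀ v : Fin (n + 1) → Bool,
      (∀ i, v (Equiv.Perm.decomposeFin.symm (p.succ, e) i) = v i) ↔
        v p.succ = v 0 ∧ ∀ i, v (e i).succ = v i.succ := fun v => by
    rw [Fin.forall_fin_succ]
    simp only [Equiv.Perm.decomposeFin_symm_apply_zero, Equiv.Perm.decomposeFin_symm_apply_succ]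
    refine and_congr_right fun h => forall_congr' fun i => ?_
    by_cases hi : e i = p
    · rw [hi, Equiv.swap_apply_right, h]
    · rw [Equiv.swap_apply_of_ne_of_ne (Fin.succ_ne_zero _) (by simpa using hi)]
  refine card_bij' (fun v _ => Fin.tail v) (fun w _ => Fin.cons (w p) w) ?_ ?_ ?_ ?_
  · intro v hv
    simp only [mem_filter, mem_univ, true_and, coordPerm_apply, funext_iff, Function.comp_apply,
      key] at hv ⊢
    exact hv.2
  · intro w hw
    simp only [mem_filter, mem_univ, true_and, coordPerm_apply, funext_iff, Function.comp_apply,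
      key] at hw ⊢
    simpa using hw
  · intro v hv
    simp only [mem_filter, mem_univ, true_and, coordPerm_apply, funext_iff, Function.comp_apply,
      key] at hv
    simp only [Fin.tail, hv.1]
    exact Fin.cons_self_tail v
  · intro w _
    exact Fin.tail_cons _ _

lemma sum_numFixed (n : ℕ) (h : ℕ → R) :
    ∑ α : Equiv.Perm (Fin n), h (numFixed α) = cycleSum n fun c => h (2 ^ c) := by
  induction n generalizing h with
  | zero => simp [cycleSum, numFixed, filter_true_of_mem, eq_iff_true_of_subsingleton]
  | succ n ih =>
    rw [← Equiv.Perm.decomposeFin.symm.sum_comp, Fintype.sum_prod_type, Fin.sum_univ_succ]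
    simp only [numFixed_decomposeFin_zero, numFixed_decomposeFin_succ, sum_const, card_univ,
      Fintype.card_fin, nsmul_eq_mul, mul_sum, ← sum_add_distrib]
    rw [ih fun F => h (2 * F) + n * h F]
    simp only [cycleSum, pow_succ']

lemma cycleSum_le (n : ℕ) (g : ℕ → ℝ) {K θ : ℝ} (hg : ∀ c ≤ n, g c ≤ K * θ ^ (n - c)) :
    cycleSum n g ≤ K * ∏ i ∈ range n, (1 + i * θ) := by
  induction n generalizing g K with
  | zero => simpa [cycleSum] using hg 0 le_rfl
  | succ n ih =>
    rw [cycleSum, prod_range_succ, mul_comm (∏ i ∈ range n, _), ← mul_assoc]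
    refine ih _ fun c hc => ?_
    have h1 := hg (c + 1) (by omega)
    have h2 := hg c (by omega)
    rw [Nat.add_sub_add_right] at h1
    rw [Nat.succ_sub hc, pow_succ] at h2
    have h3 := mul_le_mul_of_nonneg_left h2 (Nat.cast_nonneg (α := ℝ) n)
    linarith

end Stirling

section LargeRows

lemma prod_one_add_le_two (n : ℕ) (hn : 25 ≤ n) :
    ∏ i ∈ range n, (1 + i * (7 / 9 : ℝ) ^ (n + 1)) ≤ 2 := by
  have hθ : (n : ℝ) * (n - 1) * (7 / 9) ^ (n + 1) ≤ 1 := by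
    induction n, hn using Nat.le_induction with
    | base => norm_num
    | succ n hn ih =>
      have hn' : (25 : ℝ) ≤ n := by exact_mod_cast hn
      refine le_trans ?_ ih
      rw [pow_succ _ (n + 1), ← mul_assoc, mul_right_comm]
      refine mul_le_mul_of_nonneg_right ?_ (by positivity)
      push_cast
      nlinarith
  calc ∏ i ∈ range n, (1 + i * (7 / 9 : ℝ) ^ (n + 1))
      ≤ ∏ i ∈ range n, Real.exp (i * (7 / 9 : ℝ) ^ (n + 1)) := by
        refine prod_le_prod (fun i _ => by positivity) fun i _ => ?_
        rw [add_comm]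
        exact Real.add_one_le_exp _
    _ = Real.exp ((∑ i ∈ range n, (i : ℝ)) * (7 / 9) ^ (n + 1)) := by
        rw [← Real.exp_sum, sum_mul]
    _ ≤ Real.exp (Real.log 2) := by
        have h : (∑ i ∈ range n, (i : ℝ)) * 2 = n * (n - 1) := by
          have := congrArg (Nat.cast (R := ℝ)) (sum_range_id_mul_two n)
          push_cast [Nat.cast_sub (show 1 ≤ n by omega)] at this
          exact this
        have h2 := Real.log_two_gt_d9
        refine Real.exp_le_exp.2 ?_
        rw [← h] at hθ
        linarith
    _ = 2 := Real.exp_log two_pos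

lemma two_pow_mul_add_le {n c : ℕ} (hn : 25 ≤ n) (hc : c ≤ n) {s : ℝ} (hs : 0 ≤ s)
    (hsn : s ≤ n + 1) :
    (2 : ℝ) ^ c * (7 / 9) ^ (n - c) + s ≤ ((7 / 9) ^ (n - c)) ^ 2 * (2 ^ n + s) := by
  have hbase : ∀ n : ℕ, 25 ≤ n → (n : ℝ) + 1 ≤ 5 / 14 * (98 / 81) ^ n := fun n hn => by
    induction n, hn using Nat.le_induction with
    | base => norm_num
    | succ n hn ih =>
      have hn' : (25 : ℝ) ≤ n := by exact_mod_cast hn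
      rw [pow_succ]
      push_cast
      linarith
  obtain ⟨d, rfl⟩ := Nat.exists_eq_add_of_le hc
  rw [Nat.add_sub_cancel_left]
  rcases Nat.eq_zero_or_pos d with rfl | hd
  · simp
  have h1 : ((7 / 9 : ℝ) ^ d) ^ 2 * 2 ^ (c + d) = 2 ^ c * (98 / 81) ^ d := by
    rw [← pow_mul, mul_comm d 2, pow_mul, pow_add, mul_left_comm, ← mul_pow]
    norm_num
  have h2 : (7 / 9 : ℝ) ^ d ≤ 9 / 14 * (98 / 81) ^ d := by
    have : (7 / 9 : ℝ) ^ d = (9 / 14) ^ d * (98 / 81) ^ d := by rw [← mul_pow]; norm_num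
    rw [this]
    refine mul_le_mul_of_nonneg_right ?_ (by positivity)
    exact pow_le_of_le_one (by norm_num) (by norm_num) hd.ne'
  have h3 : ((98 : ℝ) / 81) ^ (c + d) ≤ 2 ^ c * (98 / 81) ^ d := by
    rw [pow_add]
    gcongr
    norm_num
  have h4 := hbase _ hn
  have h5 : (2 : ℝ) ^ c * (7 / 9) ^ d ≤ 2 ^ c * (9 / 14 * (98 / 81) ^ d) := by gcongr
  have h6 : 0 ≤ ((7 / 9 : ℝ) ^ d) ^ 2 * s := by positivity
  rw [mul_add, h1]
  linarith

lemma involutionCount_le {n c : ℕ} (hn : 25 ≤ n) (hc : c ≤ n) (r : ℕ) (hr : r ≤ n + 2) :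
    (involutionCount (2 ^ n) (2 ^ c) r : ℝ) ≤
      (2 ^ n).ascFactorial r * ((7 / 9) ^ (n - c)) ^ r := by
  induction r using Nat.twoStepInduction with
  | zero => simp [involutionCount]
  | one =>
    obtain ⟨d, rfl⟩ := Nat.exists_eq_add_of_le hc
    have : (1 : ℝ) ≤ 2 ^ d * (7 / 9) ^ d := by
      rw [← mul_pow]
      exact one_le_pow₀ (by norm_num)
    simp only [involutionCount, Nat.ascFactorial_succ, Nat.ascFactorial_zero, pow_one,
      Nat.add_sub_cancel_left]
    push_cast
    rw [pow_add, add_zero, mul_one, mul_assoc]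
    exact le_mul_of_one_le_right (by positivity) this
  | more r ih1 ih2 =>
    have h1 := ih1 (by omega)
    have h2 := ih2 (by omega)
    have hs : ((r : ℝ) + 1) ≤ n + 1 := by
      have : (r : ℝ) ≤ n := by exact_mod_cast (by omega : r ≤ n)
      linarith
    have key := two_pow_mul_add_le hn hc (by positivity) hs
    rw [involutionCount]
    rw [Nat.ascFactorial_succ] at h2 ⊢
    rw [Nat.ascFactorial_succ]
    push_cast at h1 h2 ⊢
    set l : ℝ := (7 / 9) ^ (n - c)
    set P : ℝ := ((2 ^ n).ascFactorial r : ℝ)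
    calc (2 : ℝ) ^ c * (involutionCount (2 ^ n) (2 ^ c) (r + 1) : ℝ) +
          (r + 1) * (2 ^ n + r) * (involutionCount (2 ^ n) (2 ^ c) r : ℝ)
        ≤ 2 ^ c * ((2 ^ n + r) * P * l ^ (r + 1)) + (r + 1) * (2 ^ n + r) * (P * l ^ r) := by
          gcongr
      _ = (2 ^ n + r) * P * l ^ r * (2 ^ c * l + (r + 1)) := by ring
      _ ≤ (2 ^ n + r) * P * l ^ r * (l ^ 2 * (2 ^ n + (r + 1))) := by gcongr
      _ = _ := by ring

/-- `r!` times an upper bound for the sum over all row permutations of the number of invariant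
column multisets of size `r`. -/
def totalCount (n r : ℕ) : ℕ :=
  cycleSum n fun c => involutionCount (2 ^ n) (2 ^ c) r

lemma totalCount_eq (n r : ℕ) :
    totalCount n r = ∑ α : Equiv.Perm (Fin n), involutionCount (2 ^ n) (numFixed α) r :=
  (sum_numFixed n fun F => involutionCount (2 ^ n) F r).symm

lemma totalCount_le_of_large {n r : ℕ} (hn : 25 ≤ n) (hr : n + 1 ≤ r) (hr' : r ≤ n + 2) :
    totalCount n r ≤ 2 * (2 ^ n).ascFactorial r := by
  have h : (totalCount n r : ℝ) ≤ 2 * (2 ^ n).ascFactorial r := by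
    rw [totalCount_eq, Nat.cast_sum,
      sum_numFixed n fun F => (involutionCount (2 ^ n) F r : ℝ)]
    refine (cycleSum_le n _ (K := (2 ^ n).ascFactorial r) (θ := (7 / 9) ^ (n + 1))
      fun c hc => ?_).trans ?_
    · refine (involutionCount_le hn hc r hr').trans ?_
      refine mul_le_mul_of_nonneg_left ?_ (by positivity)
      rw [← pow_mul, ← pow_mul, mul_comm (n + 1)]
      exact pow_le_pow_of_le_one (by norm_num) (by norm_num) (Nat.mul_le_mul_left _ hr)
    · rw [mul_comm]
      exact mul_le_mul_of_nonneg_right (prod_one_add_le_two n hn) (by positivity)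
  exact_mod_cast h

end LargeRows

section SmallRows

/-- An efficient form of `cycleSum`, for a function given by the list of its values. -/
def cycleSumList : ℕ → List ℕ → ℕ
  | 0, L => L.headD 0
  | n + 1, L => cycleSumList n (List.zipWith (fun a b => b + n * a) L L.tail)

lemma cycleSumList_map_range (n : ℕ) (g : ℕ → ℕ) :
    cycleSumList n ((List.range (n + 1)).map g) = cycleSum n g := by
  induction n generalizing g with
  | zero => simp [cycleSumList, cycleSum]
  | succ n ih =>
    rw [cycleSumList, cycleSum, ← ih]
    congr 1
    refine List.ext_getElem (by simp) fun i _ _ => by simp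

/-- Consecutive values of `involutionCount`. -/
def involutionCountPair (N F : ℕ) : ℕ → ℕ × ℕ
  | 0 => (1, F)
  | r + 1 =>
    let p := involutionCountPair N F r
    (p.2, F * p.2 + (r + 1) * (N + r) * p.1)

lemma involutionCountPair_eq (N F r : ℕ) :
    involutionCountPair N F r = (involutionCount N F r, involutionCount N F (r + 1)) := by
  induction r with
  | zero => rfl
  | succ r ih => simp [involutionCountPair, ih, involutionCount]

lemma totalCount_eq_list (n r : ℕ) :
    totalCount n r = cycleSumList n
      ((List.range (n + 1)).map fun c => (involutionCountPair (2 ^ n) (2 ^ c) r).1) := by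
  simp only [cycleSumList_map_range, totalCount, involutionCountPair_eq]

lemma totalCount_le_of_small {n : ℕ} (hn : n < 25) :
    totalCount n (n + 1) ≤ 2 * (2 ^ n).ascFactorial (n + 1) ∧
      totalCount n (n + 2) ≤ 2 * (2 ^ n).ascFactorial (n + 2) := by
  simp only [totalCount_eq_list]
  revert n
  decide +kernel

end SmallRows

lemma numFixed_le {n : ℕ} (α : Equiv.Perm (Fin n)) : numFixed α ≤ 2 ^ n :=
  (card_le_univ _).trans (by simp)

lemma totalCount_add_two_le (n r : ℕ) :
    totalCount n (r + 2) ≤ 2 ^ n * totalCount n (r + 1) +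
      (r + 1) * (2 ^ n + r) * totalCount n r := by
  simp only [totalCount_eq, mul_sum, ← sum_add_distrib, involutionCount]
  gcongr
  exact numFixed_le _

lemma totalCount_le {n r : ℕ} (hr : n + 1 ≤ r) :
    totalCount n r ≤ 2 * (2 ^ n).ascFactorial r := by
  have h0 : totalCount n (n + 1) ≤ 2 * (2 ^ n).ascFactorial (n + 1) ∧
      totalCount n (n + 2) ≤ 2 * (2 ^ n).ascFactorial (n + 2) := by
    rcases lt_or_ge n 25 with hn | hn
    · exact totalCount_le_of_small hn
    · exact ⟨totalCount_le_of_large hn le_rfl (by omega),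
        totalCount_le_of_large hn (by omega) le_rfl⟩
  suffices h : totalCount n r ≤ 2 * (2 ^ n).ascFactorial r ∧
      totalCount n (r + 1) ≤ 2 * (2 ^ n).ascFactorial (r + 1) from h.1
  induction r, hr using Nat.le_induction with
  | base => exact h0
  | succ r _ ih =>
    refine ⟨ih.2, (totalCount_add_two_le n r).trans ?_⟩
    calc 2 ^ n * totalCount n (r + 1) + (r + 1) * (2 ^ n + r) * totalCount n r
        ≤ 2 ^ n * (2 * (2 ^ n).ascFactorial (r + 1)) +
          (r + 1) * (2 ^ n + r) * (2 * (2 ^ n).ascFactorial r) := by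
          gcongr
          exacts [ih.2, ih.1]
      _ = _ := by
          rw [Nat.ascFactorial_succ (k := r + 1), Nat.ascFactorial_succ]
          ring

section Orbits

/-- Multisets of `r` binary vectors of length `n`. -/
abbrev ColumnMultiset (n r : ℕ) : Type :=
  {c : (Fin n → Bool) → ℕ // ∑ v, c v = r}

instance (n r : ℕ) : MulAction (Equiv.Perm (Fin n)) (ColumnMultiset n r) where
  smul α c := ⟨fun v => c.1 (coordPerm α v), (Equiv.sum_comp (coordPerm α) c.1).trans c.2⟩
  one_smul c := Subtype.ext <| funext fun v => congrArg c.1 (coordPerm_apply 1 v)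
  mul_smul α β c := Subtype.ext <| funext fun v => congrArg c.1 <| by
    simp only [coordPerm_apply]; rfl

lemma columnMultiset_smul_apply {n r : ℕ} (α : Equiv.Perm (Fin n)) (c : ColumnMultiset n r)
    (v : Fin n → Bool) : (α • c).1 v = c.1 (v ∘ α) :=
  congrArg c.1 (coordPerm_apply α v)

instance (n r : ℕ) : Finite (ColumnMultiset n r) :=
  Finite.of_injective
    (fun c => (⟨c.1, by simpa using c.2⟩ : {c // c ∈ piAntidiag (univ : Finset (Fin n → Bool)) r}))
    fun _ _ h => Subtype.ext (congrArg (fun x => x.1) h)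

/-- The multiset of columns of a matrix. -/
def columnMultiset {n r : ℕ} (M : Fin n → Fin r → Bool) : ColumnMultiset n r :=
  ⟨fun v => #{j | (fun i => M i j) = v}, by
    simpa using (card_eq_sum_card_fiberwise (f := fun j i => M i j) (s := (univ : Finset (Fin r)))
      (t := univ) fun _ _ => mem_univ _).symm⟩

lemma exists_perm_of_columnMultiset_eq {n r : ℕ} {M M' : Fin n → Fin r → Bool}
    (h : columnMultiset M = columnMultiset M') :
    ∃ β : Equiv.Perm (Fin r), ∀ i j, M' i j = M i (β j) := by
  have hv : ∀ v, Nonempty ({j // (fun i => M' i j) = v} ≃ {j // (fun i => M i j) = v}) :=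
    fun v => by
      refine Fintype.card_eq.1 ?_
      rw [Fintype.card_subtype, Fintype.card_subtype]
      exact (congrFun (congrArg Subtype.val h) v).symm
  let e := fun v => (hv v).some
  refine ⟨Equiv.ofFiberEquiv e, fun i j => ?_⟩
  exact (congrFun (Equiv.ofFiberEquiv_map e j) i).symm

lemma columnMultiset_perm {n r : ℕ} (M : Fin n → Fin r → Bool) (α : Equiv.Perm (Fin n))
    (β : Equiv.Perm (Fin r)) :
    columnMultiset (fun i j => M (α⁻¹ i) (β⁻¹ j)) = α • columnMultiset M := by
  refine Subtype.ext (funext fun v => ?_)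
  rw [columnMultiset_smul_apply]
  change #{j | (fun i => M (α⁻¹ i) (β⁻¹ j)) = v} = #{j | (fun i => M i j) = v ∘ α}
  refine card_equiv β⁻¹ fun j => ?_
  simp only [mem_filter, mem_univ, true_and, funext_iff, Function.comp_apply]
  refine ⟨fun h i => ?_, fun h i => ?_⟩
  · simpa using h (α i)
  · simpa using h (α⁻¹ i)

lemma numBip_le_card_orbits (n r : ℕ) :
    numBip n r ≤
      Nat.card (Quotient (MulAction.orbitRel (Equiv.Perm (Fin n)) (ColumnMultiset n r))) := by
  refine Nat.card_le_card_of_injective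
    (Quot.lift (fun M => Quotient.mk _ (columnMultiset M)) ?_) ?_
  · rintro M M' ⟨α, β, h⟩
    refine Quotient.sound ?_
    refine MulAction.orbitRel_apply.2 ⟨α⁻¹, ?_⟩
    obtain rfl : M' = fun i j => M (α⁻¹ i) (β⁻¹ j) := funext fun i => funext fun j => h i j
    simp only [columnMultiset_perm, inv_smul_smul]
  · rintro ⟨M⟩ ⟨M'⟩ h
    obtain ⟨α, hα⟩ := MulAction.orbitRel_apply.1 (Quotient.exact h)
    refine Quot.sound ?_
    have hα : α • columnMultiset M' = columnMultiset M := hα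
    have h' : columnMultiset (fun i j => M (α i) j) = columnMultiset M' := by
      have := columnMultiset_perm M α⁻¹ 1
      rw [← hα, inv_smul_smul] at this
      simpa using this
    obtain ⟨β, hβ⟩ := exists_perm_of_columnMultiset_eq h'
    exact ⟨α⁻¹, β⁻¹, by simpa using hβ⟩

lemma factorial_mul_numBip_le (n r : ℕ) :
    n.factorial * numBip n r ≤
      ∑ α : Equiv.Perm (Fin n), #(invariantMultisets (coordPerm α) r) := by
  classical
  have := Fintype.ofFinite (ColumnMultiset n r)
  have := Fintype.ofFinite
    (Quotient (MulAction.orbitRel (Equiv.Perm (Fin n)) (ColumnMultiset n r)))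
  have burnside := MulAction.sum_card_fixedBy_eq_card_orbits_mul_card_group
    (Equiv.Perm (Fin n)) (ColumnMultiset n r)
  rw [Fintype.card_perm, Fintype.card_fin, ← Nat.card_eq_fintype_card] at burnside
  rw [mul_comm]
  refine (Nat.mul_le_mul_right _ (numBip_le_card_orbits n r)).trans ?_
  rw [← burnside]
  refine sum_le_sum fun α _ => ?_
  rw [← Fintype.card_coe]
  refine Fintype.card_le_of_injective
    (fun c => ⟨c.1.1, mem_invariantMultisets.2 ⟨c.1.2, fun v => ?_⟩⟩) fun c c' h => ?_
  · exact congrFun (congrArg Subtype.val c.2) v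
  · exact Subtype.ext (Subtype.ext (congrArg (fun x => x.1) h))

end Orbits

/-- For `0 < n < r`, `n! · N(n,r) ≤ 2 · C(r + 2^n - 1, r)`. -/
theorem numBip_upper_bound (n r : ℕ) (hn : 0 < n) (hr : 0 < r) (hnr : n < r) :
    Nat.factorial n * numBip n r ≤ 2 * Nat.choose (r + 2 ^ n - 1) r := by
  have hsum : r.factorial * (n.factorial * numBip n r) ≤ totalCount n r := by
    refine (Nat.mul_le_mul_left _ (factorial_mul_numBip_le n r)).trans ?_
    rw [mul_sum, totalCount_eq]
    refine sum_le_sum fun α _ => ?_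
    have h := factorial_mul_card_invariantMultisets_le (coordPerm α) (z := fun _ => false)
      (coordPerm_apply α _) r
    simpa [numFixed] using h
  refine Nat.le_of_mul_le_mul_left ?_ r.factorial_pos
  calc r.factorial * (n.factorial * numBip n r) ≤ 2 * (2 ^ n).ascFactorial r :=
        hsum.trans (totalCount_le hnr)
    _ = r.factorial * (2 * Nat.choose (r + 2 ^ n - 1) r) := by
        rw [Nat.ascFactorial_eq_factorial_mul_choose', add_comm r]
        ring
end

section
/- For all positive integers n and r, the number N(n,r) of unlabeled (n,r)-bipartite graphs satisfies n! · r! · N(n,r) = Σ_{α ∈ S_n} Σ_{β ∈ S_r} 2^{c(α × β)}, where the sum is over all permutations α of Fin n and β of Fin r, α × β is the permutation of Fin n × Fin r given by (i,j) ↦ (α i, β j), and c denotes the number of cycles including fixed points. (This is Harrison's identity N(n,r) = Z_{S_n × S_r}(2, 2, …, 2).) -/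
/-- Orbit relation on `α` of the cyclic group generated by the permutation `σ`:
two points are related iff some power of `σ` maps one to the other. -/
def permOrbRel {α : Type*} (σ : Equiv.Perm α) (x y : α) : Prop :=
  ∃ k : ℤ, (σ ^ k) x = y

/-- Number of cycles of a permutation, counting fixed points as cycles of length 1:
the number of orbits of the subgroup generated by `σ`. -/
noncomputable def cycleCount {α : Type*} (σ : Equiv.Perm α) : ℕ :=
  Nat.card (Quot (permOrbRel σ))

/-- The size (length) of a cycle of a permutation, viewed as an orbit class. -/
noncomputable def orbSize {α : Type*} {r : α → α → Prop} (q : Quot r) : ℕ :=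
  Nat.card {x // Quot.mk r x = q}

/-- Functions invariant under `σ` correspond to functions on the set of cycles of `σ`. -/
def invariantFunEquiv {γ κ : Type*} (σ : Equiv.Perm γ) :
    {f : γ → κ // ∀ x, f (σ x) = f x} ≃ (Quot (permOrbRel σ) → κ) where
  toFun f := Quot.lift f.1 (by
    rintro x _ ⟨k, rfl⟩
    induction k using Int.induction_on with
    | zero => simp
    | succ m ih => rw [add_comm, zpow_add, zpow_one, Equiv.Perm.mul_apply, f.2, ih]
    | pred m ih =>
      rw [ih, ← f.2 ((σ ^ (-(m : ℤ) - 1)) x), ← Equiv.Perm.mul_apply, ← zpow_one_add,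
        add_sub_cancel])
  invFun g := ⟨fun x => g (Quot.mk _ x), fun x =>
    congrArg g (Quot.sound ⟨-1, by simp⟩)⟩
  left_inv _ := rfl
  right_inv g := funext fun q => Quot.inductionOn q fun _ => rfl

theorem card_invariant_eq_pow_cycleCount {γ : Type*} [Finite γ] (κ : Type*)
    (σ : Equiv.Perm γ) :
    Nat.card {f : γ → κ // ∀ x, f (σ x) = f x} = Nat.card κ ^ cycleCount σ := by
  have : Finite (Quot (permOrbRel σ)) := Quot.finite _
  rw [Nat.card_congr (invariantFunEquiv σ), Nat.card_fun, cycleCount]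

/-- The action of a product of symmetric groups on matrices by permuting rows and columns. -/
abbrev permMatrixAction (ι ι' κ : Type*) :
    MulAction (Equiv.Perm ι × Equiv.Perm ι') (ι → ι' → κ) where
  smul g M i j := M (g.1⁻¹ i) (g.2⁻¹ j)
  one_smul _ := rfl
  mul_smul g h M := by
    funext i j
    change M ((g.1 * h.1)⁻¹ i) ((g.2 * h.2)⁻¹ j) = M (h.1⁻¹ (g.1⁻¹ i)) (h.2⁻¹ (g.2⁻¹ j))
    simp only [mul_inv_rev, Equiv.Perm.mul_apply]

attribute [local instance] permMatrixAction

theorem permMatrix_smul_apply {ι ι' κ : Type*} (g : Equiv.Perm ι × Equiv.Perm ι')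
    (M : ι → ι' → κ) (i : ι) (j : ι') : (g • M) i j = M (g.1⁻¹ i) (g.2⁻¹ j) := rfl

/-- A matrix fixed by a pair of permutations is a function invariant under their product. -/
def fixedMatrixEquiv {ι ι' κ : Type*} (g : Equiv.Perm ι × Equiv.Perm ι') :
    MulAction.fixedBy (ι → ι' → κ) g ≃
      {f : ι × ι' → κ // ∀ x, f (Equiv.prodCongr g.1 g.2 x) = f x} :=
  (Equiv.curry ι ι' κ).symm.subtypeEquiv fun M => by
    rw [MulAction.mem_fixedBy]
    constructor
    · rintro h ⟨i, j⟩
      simpa [permMatrix_smul_apply] using (congrFun₂ h (g.1 i) (g.2 j)).symm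
    · intro h
      funext i j
      simpa [permMatrix_smul_apply] using (h (g.1⁻¹ i, g.2⁻¹ j)).symm

theorem numBip_eq_card_orbits (n r : ℕ) :
    numBip n r = Nat.card (MulAction.orbitRel.Quotient
      (Equiv.Perm (Fin n) × Equiv.Perm (Fin r)) (Fin n → Fin r → Bool)) := by
  refine Nat.card_congr (Quot.congrRight fun M M' => ?_)
  rw [Setoid.comm', MulAction.orbitRel_apply, MulAction.mem_orbit_iff]
  simp only [Prod.exists, funext_iff, permMatrix_smul_apply, eq_comm]

/-- Harrison's identity `N(n,r) = Z_{S_n × S_r}(2, 2, …, 2)`, stated as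
`n! · r! · N(n,r) = Σ_{α ∈ S_n} Σ_{β ∈ S_r} 2^{c(α × β)}`. -/
theorem numBip_eq_cycleIndex_prod (n r : ℕ) (hn : 0 < n) (hr : 0 < r) :
    Nat.factorial n * Nat.factorial r * numBip n r =
      ∑ α : Equiv.Perm (Fin n), ∑ β : Equiv.Perm (Fin r),
        2 ^ cycleCount (Equiv.prodCongr α β) := by
  classical
  have := MulAction.sum_card_fixedBy_eq_card_orbits_mul_card_group
    (Equiv.Perm (Fin n) × Equiv.Perm (Fin r)) (Fin n → Fin r → Bool)
  simp only [← Nat.card_eq_fintype_card, Nat.card_congr (fixedMatrixEquiv _),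
    card_invariant_eq_pow_cycleCount, ← numBip_eq_card_orbits, Nat.card_prod, Nat.card_perm,
    Nat.card_fin, Fintype.sum_prod_type] at this
  rw [mul_comm, ← this, Nat.card_eq_fintype_card, Fintype.card_bool]
end

section
/- For any permutation σ of Fin n and any positive integer r, Σ_{β ∈ S_r} 2^{c(σ × β)} = Σ_{β ∈ S_r} Π_{cycles c of β} 2^{g_σ(length of c)}, where the product runs over all cycles of β including fixed points as cycles of length 1, g_σ(j) = Σ_{cycles d of σ} gcd(length of d, j) with fixed points of σ counted as cycles of length 1, σ × β is the permutation of Fin n × Fin r given by (i,j) ↦ (σ i, β j), and c(σ × β) is its number of cycles including fixed points. (This expresses the identity [Z_{S_n}[i] ⊠ Z_{S_r}](2,…,2) = (1/n!) Z_{S_r}(2^{g_σ(1)}, …, 2^{g_σ(r)}) for the term of the cycle index of S_n corresponding to σ.) -/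
/-- `g_σ(j) = Σ_{cycles d of σ} gcd(length d, j)`, with fixed points of `σ`
counted as cycles of length 1. -/
noncomputable def gSum {n : ℕ} (σ : Equiv.Perm (Fin n)) (j : ℕ) : ℕ :=
  ∑ᶠ d : Quot (permOrbRel σ), Nat.gcd (orbSize d) j

theorem permOrbRel_mk_eq_iff {α : Type*} (σ : Equiv.Perm α) (x y : α) :
    Quot.mk (permOrbRel σ) x = Quot.mk (permOrbRel σ) y ↔ σ.SameCycle x y :=
  Quotient.eq (r := Equiv.Perm.SameCycle.setoid σ)

theorem orbSize_mk {α : Type*} (σ : Equiv.Perm α) (x : α) :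
    orbSize (Quot.mk (permOrbRel σ) x) = Function.minimalPeriod σ x := by
  have h : {y | Quot.mk (permOrbRel σ) y = Quot.mk (permOrbRel σ) x} =
      MulAction.orbit (Subgroup.zpowers σ) x := by
    ext y
    rw [Set.mem_ofPred_eq, permOrbRel_mk_eq_iff, Equiv.Perm.sameCycle_comm]
    constructor
    · rintro ⟨k, hk⟩
      exact ⟨⟨σ ^ k, k, rfl⟩, hk⟩
    · rintro ⟨⟨_, k, rfl⟩, hk⟩
      exact ⟨k, hk⟩
  calc orbSize (Quot.mk (permOrbRel σ) x)
      = Nat.card {y | Quot.mk (permOrbRel σ) y = Quot.mk (permOrbRel σ) x} := rfl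
    _ = Nat.card (MulAction.orbit (Subgroup.zpowers σ) x) := by rw [h]
    _ = Nat.card (ZMod (Function.minimalPeriod (σ • ·) x)) :=
        Nat.card_congr (MulAction.orbitZPowersEquiv σ x)
    _ = Function.minimalPeriod σ x := Nat.card_zmod _

theorem minimalPeriod_perm_pos {α : Type*} [Finite α] (σ : Equiv.Perm α) (x : α) :
    0 < Function.minimalPeriod σ x :=
  Function.minimalPeriod_pos_of_mem_periodicPts
    (Function.Injective.mem_periodicPts σ.injective x)

theorem sum_orbits_eq {α : Type*} [Fintype α] (σ : Equiv.Perm α)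
    [Fintype (Quot (permOrbRel σ))] (f : ℕ → ℚ) :
    ∑ q : Quot (permOrbRel σ), f (orbSize q) =
      ∑ x, f (Function.minimalPeriod σ x) / Function.minimalPeriod σ x := by
  classical
  rw [← Finset.sum_fiberwise Finset.univ (Quot.mk (permOrbRel σ))]
  refine Finset.sum_congr rfl fun q _ => ?_
  have hcard : (Finset.univ.filter fun x => Quot.mk (permOrbRel σ) x = q).card = orbSize q := by
    rw [orbSize, Nat.card_eq_fintype_card, Fintype.card_subtype]
  have hpos : (orbSize q : ℚ) ≠ 0 := by
    obtain ⟨x, rfl⟩ := Quot.exists_rep q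
    rw [orbSize_mk]
    exact_mod_cast (minimalPeriod_perm_pos σ x).ne'
  rw [Finset.sum_congr rfl (g := fun _ => f (orbSize q) / orbSize q), Finset.sum_const, hcard,
    nsmul_eq_mul, mul_div_cancel₀ _ hpos]
  intro x hx
  rw [← (Finset.mem_filter.1 hx).2, orbSize_mk]

theorem cycleCount_prodCongr {n r : ℕ} (σ : Equiv.Perm (Fin n)) (β : Equiv.Perm (Fin r))
    [Fintype (Quot (permOrbRel β))] :
    cycleCount (Equiv.prodCongr σ β) = ∑ c : Quot (permOrbRel β), gSum σ (orbSize c) := by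
  classical
  have := Fintype.ofFinite (Quot (permOrbRel σ))
  have := Fintype.ofFinite (Quot (permOrbRel (Equiv.prodCongr σ β)))
  have hg (j : ℕ) : (gSum σ j : ℚ) =
      ∑ x, (Nat.gcd (Function.minimalPeriod σ x) j : ℚ) / Function.minimalPeriod σ x := by
    rw [gSum, finsum_eq_sum_of_fintype, Nat.cast_sum]
    exact sum_orbits_eq σ fun k => (Nat.gcd k j : ℚ)
  have hc : (cycleCount (Equiv.prodCongr σ β) : ℚ) =
      ∑ p, (1 : ℚ) / Function.minimalPeriod (Equiv.prodCongr σ β) p := by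
    rw [← sum_orbits_eq (Equiv.prodCongr σ β) fun _ => 1]
    simp [cycleCount]
  rw [← Nat.cast_inj (R := ℚ), hc, Nat.cast_sum, sum_orbits_eq β fun k => (gSum σ k : ℚ),
    Fintype.sum_prod_type_right]
  refine Finset.sum_congr rfl fun y _ => ?_
  rw [hg, Finset.sum_div]
  refine Finset.sum_congr rfl fun x _ => ?_
  rw [show ⇑(Equiv.prodCongr σ β) = Prod.map σ β from rfl, Function.minimalPeriod_prodMap]
  have hx : (Function.minimalPeriod σ x : ℚ) ≠ 0 :=
    Nat.cast_ne_zero.2 (minimalPeriod_perm_pos σ x).ne'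
  have hy : (Function.minimalPeriod β y : ℚ) ≠ 0 :=
    Nat.cast_ne_zero.2 (minimalPeriod_perm_pos β y).ne'
  have hl : ((Function.minimalPeriod σ x).lcm (Function.minimalPeriod β y) : ℚ) ≠ 0 :=
    Nat.cast_ne_zero.2
      (Nat.lcm_pos (minimalPeriod_perm_pos σ x) (minimalPeriod_perm_pos β y)).ne'
  rw [div_div, div_eq_div_iff hl (mul_ne_zero hx hy), one_mul]
  exact_mod_cast (Nat.gcd_mul_lcm _ _).symm

/-- `Σ_{β ∈ S_r} 2^{c(σ × β)} = Σ_{β ∈ S_r} Π_{cycles c of β} 2^{g_σ(length c)}`,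
i.e. `[Z_{S_n}[σ] ⊠ Z_{S_r}](2,…,2) = (1/n!) Z_{S_r}(2^{g_σ(1)}, …, 2^{g_σ(r)})`. -/
theorem sum_pow_cycleCount_prodCongr (n r : ℕ) (hr : 0 < r) (σ : Equiv.Perm (Fin n)) :
    ∑ β : Equiv.Perm (Fin r), 2 ^ cycleCount (Equiv.prodCongr σ β) =
      ∑ β : Equiv.Perm (Fin r), ∏ᶠ c : Quot (permOrbRel β), 2 ^ gSum σ (orbSize c) := by
  refine Finset.sum_congr rfl fun β _ => ?_
  have := Fintype.ofFinite (Quot (permOrbRel β))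
  rw [cycleCount_prodCongr, finprod_eq_prod_of_fintype, Finset.prod_pow_eq_pow_sum]
end
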